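/- arXiv:2112.03789 — 6 statements merged into one kernel-verified Lean document; each statement's English description precedes it below -/
import Mathlib

section
/- Let c̄ > 0 and δ > 0, and let ρ, μ, σ, Y be real numbers with 0 ≤ Y ≤ 1/2, 2ρ + μ − σ² > 0, |ρ| ≤ c̄, |μ| ≤ c̄ and ρ ≥ δ. Then β̃ = (ρ + μ)Y / (σ²Y + (1/2)(2ρ + μ − σ²)) satisfies β̃ ≤ max{1 − δ/(3c̄), 0} < 1. -/
theorem stmt_1 (cbar δ ρ μ σ Y : ℝ)
    (hc : cbar > 0) (hδ : δ > 0)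
    (hY0 : 0 ≤ Y) (hY1 : Y ≤ 1/2)
    (hpos : 2*ρ + μ - σ^2 > 0)
    (hρbd : |ρ| ≤ cbar) (hμbd : |μ| ≤ cbar) (hρδ : ρ ≥ δ) :
    (ρ + μ) * Y / (σ^2 * Y + (1/2) * (2*ρ + μ - σ^2)) ≤ max (1 - δ / (3*cbar)) 0 ∧
    max (1 - δ / (3*cbar)) 0 < 1 := by
  have hρ := (abs_le.mp hρbd).2
  have hμ := (abs_le.mp hμbd).2
  have ht : 0 < δ / (3*cbar) := by positivity
  refine ⟨?_, max_lt (by linarith) one_pos⟩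
  have hsY : 0 ≤ σ^2 * Y := by positivity
  have hD : 0 < σ^2 * Y + (1/2) * (2*ρ + μ - σ^2) := by linarith
  rcases le_total 0 (ρ + μ) with h | h
  · refine le_max_of_le_left ((div_le_iff₀ hD).mpr ?_)
    have htc : δ / (3*cbar) * (3*cbar) = δ := by field_simp
    have ht1 : δ / (3*cbar) ≤ 1 := (div_le_one (by positivity)).mpr (by linarith)
    have hk : ρ + μ ≤ (1 - δ / (3*cbar)) * (2*ρ + μ) := by
      have := mul_le_mul_of_nonneg_left (show 2*ρ + μ ≤ 3*cbar by linarith) ht.le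
      linarith
    have hDY : (2*ρ + μ) * Y ≤ σ^2 * Y + (1/2) * (2*ρ + μ - σ^2) := by
      have := mul_nonneg hpos.le (sub_nonneg.mpr hY1)
      linarith
    calc (ρ + μ) * Y ≤ (1 - δ / (3*cbar)) * (2*ρ + μ) * Y :=
          mul_le_mul_of_nonneg_right hk hY0
      _ = (1 - δ / (3*cbar)) * ((2*ρ + μ) * Y) := by ring
      _ ≤ _ := mul_le_mul_of_nonneg_left hDY (sub_nonneg.mpr ht1)
  · exact le_max_of_le_right
      (div_nonpos_of_nonpos_of_nonneg (mul_nonpos_of_nonpos_of_nonneg h hY0) hD.le)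
end

section
/- Let c̄ > 0, δ > 0 and let ρ, μ, σ, Y be real numbers with Y ≥ 0, |μ| ≤ c̄, ρ ≤ −δ and 2ρ + μ − σ² > 0. If 2Y > 1 − δ/(c̄ − δ), then β̃ = (ρ + μ)Y / (σ²Y + (1/2)(2ρ + μ − σ²)) satisfies β̃ > 1. -/
theorem stmt_4 (cbar δ ρ μ σ Y : ℝ)
    (hc : cbar > 0) (hδ : δ > 0) (hY : Y ≥ 0)
    (hμbd : |μ| ≤ cbar) (hρ : ρ ≤ -δ) (hpos : 2*ρ + μ - σ^2 > 0)
    (h2Y : 2*Y > 1 - δ / (cbar - δ)) :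
    (ρ + μ) * Y / (σ^2 * Y + (1/2) * (2*ρ + μ - σ^2)) > 1 := by
  have hσ : 0 ≤ σ ^ 2 := sq_nonneg σ
  have hA : 0 < ρ + μ - σ ^ 2 := by linarith
  have hAd : ρ + μ - σ ^ 2 ≤ cbar - δ := by linarith [le_of_abs_le hμbd]
  have hd : 0 < cbar - δ := hA.trans_le hAd
  have hden : 0 < σ ^ 2 * Y + (1/2) * (2*ρ + μ - σ ^ 2) := by
    linarith [mul_nonneg hσ hY]
  have hmul := mul_lt_mul_of_pos_right h2Y hA
  have hle : δ / (cbar - δ) * (ρ + μ - σ ^ 2) ≤ δ := by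
    calc δ / (cbar - δ) * (ρ + μ - σ ^ 2) ≤ δ / (cbar - δ) * (cbar - δ) := by gcongr
      _ = δ := div_mul_cancel₀ δ hd.ne'
  rw [gt_iff_lt, one_lt_div hden]
  linarith
end

section
/- Let ε̄ > 0, c̄ > 0 and let ρ, μ, σ be real numbers with 2ρ + μ − σ² ≥ ε̄ and |μ| ≤ c̄. Define the truncation L(y) = min(max(y, 0), 1/2) and the truncated driver f̄(y) = −(ρ + μ)² L(y)² / (σ² L(y) + (1/2)(2ρ + μ − σ²)) + μ L(y) for y ∈ ℝ. Then for all y, y′ ∈ ℝ, (f̄(y) − f̄(y′)) · (y − y′) ≤ c̄ · (y − y′)². -/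
/-- The map `l ↦ K l² / (S l + d)` is monotone on the nonnegative reals. -/
theorem mul_sq_div_linear_mono {K S d a b : ℝ} (hK : 0 ≤ K) (hS : 0 ≤ S) (hd : 0 < d)
    (hb : 0 ≤ b) (hba : b ≤ a) :
    K * b ^ 2 / (S * b + d) ≤ K * a ^ 2 / (S * a + d) := by
  have ha : 0 ≤ a := hb.trans hba
  rw [mul_div_assoc, mul_div_assoc]
  refine mul_le_mul_of_nonneg_left ?_ hK
  rw [div_le_div_iff₀ (by positivity) (by positivity)]
  have h₁ : 0 ≤ S * (a * b) * (a - b) := mul_nonneg (by positivity) (sub_nonneg.2 hba)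
  have h₂ : 0 ≤ d * (a + b) * (a - b) := mul_nonneg (by positivity) (sub_nonneg.2 hba)
  linarith

/-- The truncation to `[0, c]` is nondecreasing and 1-Lipschitz. -/
theorem truncation_sub_le {x y c : ℝ} (h : x ≤ y) :
    min (max y 0) c - min (max x 0) c ≤ y - x := by
  grind

theorem stmt_5 (εbar cbar ρ μ σ : ℝ)
    (hε : εbar > 0) (hc : cbar > 0)
    (hpos : 2*ρ + μ - σ^2 ≥ εbar) (hμbd : |μ| ≤ cbar)
    (L : ℝ → ℝ) (hL : ∀ y, L y = min (max y 0) (1/2))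
    (fbar : ℝ → ℝ)
    (hf : ∀ y, fbar y =
      -((ρ + μ)^2 * (L y)^2) / (σ^2 * L y + (1/2) * (2*ρ + μ - σ^2)) + μ * L y) :
    ∀ y y' : ℝ, (fbar y - fbar y') * (y - y') ≤ cbar * (y - y')^2 := by
  have key : ∀ y y' : ℝ, y' ≤ y → (fbar y - fbar y') * (y - y') ≤ cbar * (y - y')^2 := by
    intro y y' h
    have hnonneg : 0 ≤ L y' := by
      rw [hL]
      exact le_min (le_max_right _ _) (by norm_num)
    have hmono : L y' ≤ L y := by
      rw [hL, hL]
      gcongr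
    have hlip : L y - L y' ≤ y - y' := by
      rw [hL, hL]
      exact truncation_sub_le h
    have hg := mul_sq_div_linear_mono (sq_nonneg (ρ + μ)) (sq_nonneg σ)
      (d := (1/2) * (2*ρ + μ - σ^2)) (by linarith) hnonneg hmono
    have hdiff : fbar y - fbar y' ≤ cbar * (y - y') :=
      calc fbar y - fbar y' ≤ μ * (L y - L y') := by
            rw [hf, hf, neg_div, neg_div]
            linarith
        _ ≤ cbar * (L y - L y') :=
            mul_le_mul_of_nonneg_right ((le_abs_self μ).trans hμbd) (sub_nonneg.2 hmono)
        _ ≤ cbar * (y - y') := mul_le_mul_of_nonneg_left hlip hc.le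
    calc (fbar y - fbar y') * (y - y') ≤ cbar * (y - y') * (y - y') :=
          mul_le_mul_of_nonneg_right hdiff (sub_nonneg.2 h)
      _ = cbar * (y - y')^2 := by ring
  intro y y'
  rcases le_total y' y with h | h
  · exact key y y' h
  · linarith [key y' y h]
end

section
/- Let T > 0, μ > 0, N ∈ ℕ, let 0 = T₀ < T₁ < … < T_N = T, and let ρ^{(1)}, …, ρ^{(N)} ∈ (−μ/2, ∞). Define ρ : [0, T] → ℝ by ρ_t = ρ^{(i)} for t ∈ [T_{i−1}, T_i) (and ρ_T = ρ^{(N)}), and define Y : [0, T] → ℝ by Y_t = e^{(T−t)μ} · ( ∫_t^T ((ρ_s + μ)² / (ρ_s + μ/2)) e^{(T−s)μ} ds + 2 )^{−1}. Then Y is continuous on [0, T], satisfies 0 < Y_t ≤ 1/2 for all t ∈ [0, T], Y_T = 1/2, and for each i ∈ {1, …, N} and each t ∈ (T_{i−1}, T_i), Y is differentiable at t with derivative ((ρ^{(i)} + μ)² / (ρ^{(i)} + μ/2)) Y_t² − μ Y_t. -/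
theorem exists_mem_Ico_of_mem_Ico (a : ℕ → ℝ) (n : ℕ) {x : ℝ} (hx : x ∈ Set.Ico (a 0) (a n)) :
    ∃ i ∈ Finset.Icc 1 n, x ∈ Set.Ico (a (i - 1)) (a i) := by
  induction n with
  | zero => exact absurd hx.1 (not_le.mpr hx.2)
  | succ n ih =>
    rcases lt_or_ge x (a n) with h | h
    · obtain ⟨i, hi, hxi⟩ := ih ⟨hx.1, h⟩
      exact ⟨i, Finset.Icc_subset_Icc_right n.le_succ hi, hxi⟩
    · exact ⟨n + 1, by simp, h, hx.2⟩

theorem le_of_forall_lt_succ {a : ℕ → ℝ} {n : ℕ} (ha : ∀ i < n, a i < a (i + 1)) {i j : ℕ}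
    (hij : i ≤ j) (hj : j ≤ n) : a i ≤ a j := by
  induction j, hij using Nat.le_induction with
  | base => exact le_rfl
  | succ j _ ih => exact (ih (by omega)).trans (ha j (by omega)).le

theorem intervalIntegrable_of_eqOn_Ico_continuous {a : ℕ → ℝ} {n : ℕ}
    (ha : ∀ i < n, a i < a (i + 1)) {f : ℝ → ℝ} {g : ℕ → ℝ → ℝ}
    (hg : ∀ i ∈ Finset.Icc 1 n, Continuous (g i))
    (hfg : ∀ i ∈ Finset.Icc 1 n, Set.EqOn f (g i) (Set.Ico (a (i - 1)) (a i))) :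
    IntervalIntegrable f MeasureTheory.volume (a 0) (a n) := by
  refine IntervalIntegrable.trans_iterate fun k hk => ?_
  have hk' : k + 1 ∈ Finset.Icc 1 n := by simp; omega
  have h := (hg _ hk').intervalIntegrable (μ := MeasureTheory.volume) (a k) (a (k + 1))
  rw [intervalIntegrable_iff_integrableOn_Ico_of_le (ha k hk).le] at h ⊢
  exact h.congr_fun (fun x hx => (hfg _ hk' hx).symm) measurableSet_Ico

theorem two_mul_le_add_sq_div_add_half {r m : ℝ} (h : -m / 2 < r) :
    2 * m ≤ (r + m) ^ 2 / (r + m / 2) := by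
  rw [le_div_iff₀ (by linarith)]
  nlinarith [sq_nonneg r]

theorem integral_two_mul_exp_sub_mul (T m t : ℝ) :
    ∫ s in t..T, 2 * m * Real.exp ((T - s) * m) = 2 * Real.exp ((T - t) * m) - 2 := by
  have h : ∀ s ∈ Set.uIcc t T, HasDerivAt (fun s => -2 * Real.exp ((T - s) * m))
      (2 * m * Real.exp ((T - s) * m)) s := fun s _ => by
    refine HasDerivAt.congr_deriv
      ((((hasDerivAt_id' s).const_sub T).mul_const m).exp.const_mul (-2)) ?_
    ring
  rw [intervalIntegral.integral_eq_sub_of_hasDerivAt h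
    (Continuous.intervalIntegrable (by fun_prop) _ _)]
  simp
  ring

open intervalIntegral in
theorem stmt_9 (T μ : ℝ) (hT : 0 < T) (hμ : 0 < μ)
    (N : ℕ) (hN : 0 < N)
    (Ts : ℕ → ℝ) (hTs0 : Ts 0 = 0) (hTsN : Ts N = T)
    (hTsmono : ∀ i < N, Ts i < Ts (i+1))
    (ρv : ℕ → ℝ) (hρv : ∀ i ∈ Finset.Icc 1 N, ρv i > -μ/2)
    (ρ : ℝ → ℝ)
    (hρ : ∀ i ∈ Finset.Icc 1 N, ∀ t ∈ Set.Ico (Ts (i-1)) (Ts i), ρ t = ρv i)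
    (hρT : ρ T = ρv N)
    (Y : ℝ → ℝ)
    (hY : ∀ t ∈ Set.Icc 0 T, Y t =
      Real.exp ((T - t) * μ) *
        ((∫ s in t..T, ((ρ s + μ)^2 / (ρ s + μ/2)) * Real.exp ((T - s) * μ)) + 2)⁻¹) :
    ContinuousOn Y (Set.Icc 0 T) ∧
    (∀ t ∈ Set.Icc 0 T, 0 < Y t ∧ Y t ≤ 1/2) ∧
    Y T = 1/2 ∧
    (∀ i ∈ Finset.Icc 1 N, ∀ t ∈ Set.Ioo (Ts (i-1)) (Ts i),
      HasDerivAt Y (((ρv i + μ)^2 / (ρv i + μ/2)) * (Y t)^2 - μ * Y t) t) := by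
  set f : ℝ → ℝ := fun s => ((ρ s + μ)^2 / (ρ s + μ/2)) * Real.exp ((T - s) * μ) with hf
  set g : ℕ → ℝ → ℝ := fun i s =>
    ((ρv i + μ)^2 / (ρv i + μ/2)) * Real.exp ((T - s) * μ) with hg
  have g_cont : ∀ i, Continuous (g i) := fun i => by fun_prop
  have f_eq : ∀ i ∈ Finset.Icc 1 N, Set.EqOn f (g i) (Set.Ico (Ts (i - 1)) (Ts i)) :=
    fun i hi s hs => by simp only [hf, hg, hρ i hi s hs]
  have f_int : IntervalIntegrable f MeasureTheory.volume 0 T := by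
    have h := intervalIntegrable_of_eqOn_Ico_continuous hTsmono (fun i _ => g_cont i) f_eq
    rwa [hTs0, hTsN] at h
  have ρ_gt : ∀ s ∈ Set.Icc 0 T, -μ/2 < ρ s := by
    intro s hs
    rcases hs.2.eq_or_lt with rfl | h
    · rw [hρT]
      exact hρv N (by simp; omega)
    · obtain ⟨i, hi, hsi⟩ := exists_mem_Ico_of_mem_Ico Ts N (x := s)
        (by rw [hTs0, hTsN]; exact ⟨hs.1, h⟩)
      rw [hρ i hi s hsi]
      exact hρv i hi
  have YT : Y T = 1/2 := by
    rw [hY T ⟨hT.le, le_rfl⟩]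
    simp
  have mass_ge : ∀ t ∈ Set.Icc 0 T,
      2 * Real.exp ((T - t) * μ) - 2 ≤ ∫ s in t..T, f s := fun t ht => by
    rw [← integral_two_mul_exp_sub_mul]
    refine integral_mono_on ht.2 (Continuous.intervalIntegrable (by fun_prop) _ _)
      (f_int.mono_set ?_) fun s hs => ?_
    · rw [Set.uIcc_of_le ht.2, Set.uIcc_of_le hT.le]
      exact Set.Icc_subset_Icc_left ht.1
    · exact mul_le_mul_of_nonneg_right
        (two_mul_le_add_sq_div_add_half (ρ_gt s ⟨ht.1.trans hs.1, hs.2⟩)) (Real.exp_pos _).le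
  have denom_pos : ∀ t ∈ Set.Icc 0 T, 0 < (∫ s in t..T, f s) + 2 := fun t ht => by
    linarith [mass_ge t ht, Real.exp_pos ((T - t) * μ)]
  refine ⟨?_, fun t ht => ?_, YT, fun i hi t ht => ?_⟩
  · refine ContinuousOn.congr ?_ hY
    have h : ContinuousOn (fun t => ∫ s in t..T, f s) (Set.Icc 0 T) := by
      rw [← Set.uIcc_of_le hT.le]
      exact continuousOn_primitive_interval_left (by
        rw [Set.uIcc_of_le hT.le]
        exact (intervalIntegrable_iff_integrableOn_Icc_of_le hT.le).mp f_int)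
    exact (Continuous.continuousOn (by fun_prop)).mul
      ((h.add continuousOn_const).inv₀ fun t ht => (denom_pos t ht).ne')
  · rw [hY t ht]
    refine ⟨mul_pos (Real.exp_pos _) (inv_pos.mpr (denom_pos t ht)), ?_⟩
    rw [← div_eq_mul_inv, div_le_iff₀ (denom_pos t ht)]
    linarith [mass_ge t ht]
  · have hiN := Finset.mem_Icc.mp hi
    have h_left : 0 ≤ Ts (i - 1) := hTs0 ▸ le_of_forall_lt_succ hTsmono (Nat.zero_le _) (by omega)
    have h_right : Ts i ≤ T := hTsN ▸ le_of_forall_lt_succ hTsmono hiN.2 le_rfl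
    have htT : t ∈ Set.Icc 0 T := ⟨h_left.trans ht.1.le, ht.2.le.trans h_right⟩
    have f_cont : ContinuousOn f (Set.Ioo (Ts (i - 1)) (Ts i)) :=
      (g_cont i).continuousOn.congr ((f_eq i hi).mono Set.Ioo_subset_Ico_self)
    have f_int_t : IntervalIntegrable f MeasureTheory.volume t T := f_int.mono_set (by
      rw [Set.uIcc_of_le htT.2, Set.uIcc_of_le hT.le]
      exact Set.Icc_subset_Icc_left htT.1)
    have mass_deriv := integral_hasDerivAt_left f_int_t
      (f_cont.stronglyMeasurableAtFilter isOpen_Ioo t ht)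
      (f_cont.continuousAt (isOpen_Ioo.mem_nhds ht))
    have exp_deriv := (((hasDerivAt_id' t).const_sub T).mul_const μ).exp
    have h := exp_deriv.mul ((mass_deriv.add_const 2).inv (denom_pos t htT).ne')
    have Y_eq : Y =ᶠ[nhds t] fun t => Real.exp ((T - t) * μ) * ((∫ s in t..T, f s) + 2)⁻¹ :=
      Filter.eventuallyEq_of_mem (isOpen_Ioo.mem_nhds ht) fun s hs =>
        hY s ⟨h_left.trans hs.1.le, hs.2.le.trans h_right⟩
    refine (h.congr_of_eventuallyEq Y_eq).congr_deriv ?_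
    rw [hY t htT, f_eq i hi (Set.Ioo_subset_Ico_self ht)]
    have hD := (denom_pos t htT).ne'
    simp only [hg, Pi.inv_apply]
    generalize (ρv i + μ) ^ 2 / (ρv i + μ / 2) = c
    field_simp
    ring
end

section
/- Let μ, ρ ∈ ℝ, let a < b be reals, and let β : ℝ → ℝ be a continuous function with β_t > 0 for all t ∈ (a, b), which at every t ∈ (a, b) is differentiable with derivative β_t² (ρ + μ) − μ β_t. Define E(t) = exp( −∫_0^t β_s (μ + ρ) ds ) and h(t) = (1 − β_t) E(t). Then: if ρ > 0, h is strictly decreasing on (a, b); if ρ < 0, h is strictly increasing on (a, b); and if ρ = 0, h is constant on (a, b). -/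
theorem hasDerivAt_one_sub_mul_exp_neg_integral {β : ℝ → ℝ} {μ ρ t : ℝ} (hβc : Continuous β)
    (hβ : HasDerivAt β ((β t) ^ 2 * (ρ + μ) - μ * β t) t) :
    HasDerivAt (fun t => (1 - β t) * Real.exp (-(∫ s in (0:ℝ)..t, β s * (μ + ρ))))
      (-ρ * (β t * Real.exp (-(∫ s in (0:ℝ)..t, β s * (μ + ρ))))) t := by
  have hI : HasDerivAt (fun t => ∫ s in (0:ℝ)..t, β s * (μ + ρ)) (β t * (μ + ρ)) t :=
    (hβc.mul continuous_const).integral_hasStrictDerivAt 0 t |>.hasDerivAt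
  refine ((hβ.const_sub 1).mul hI.fun_neg.exp).congr_deriv ?_
  ring

open intervalIntegral in
theorem stmt_14 (μ ρ : ℝ) (a b : ℝ) (hab : a < b)
    (β : ℝ → ℝ) (hβc : Continuous β)
    (hβpos : ∀ t ∈ Set.Ioo a b, 0 < β t)
    (hβ : ∀ t ∈ Set.Ioo a b, HasDerivAt β ((β t)^2 * (ρ + μ) - μ * β t) t) :
    (ρ > 0 → StrictAntiOn
      (fun t => (1 - β t) * Real.exp (-(∫ s in (0:ℝ)..t, β s * (μ + ρ)))) (Set.Ioo a b)) ∧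
    (ρ < 0 → StrictMonoOn
      (fun t => (1 - β t) * Real.exp (-(∫ s in (0:ℝ)..t, β s * (μ + ρ)))) (Set.Ioo a b)) ∧
    (ρ = 0 → ∀ s ∈ Set.Ioo a b, ∀ t ∈ Set.Ioo a b,
      (1 - β s) * Real.exp (-(∫ u in (0:ℝ)..s, β u * (μ + ρ))) =
      (1 - β t) * Real.exp (-(∫ u in (0:ℝ)..t, β u * (μ + ρ)))) := by
  have hd := fun t ht => hasDerivAt_one_sub_mul_exp_neg_integral hβc (hβ t ht)
  have hc := HasDerivAt.continuousOn hd
  have hpos : ∀ t ∈ Set.Ioo a b,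
      0 < β t * Real.exp (-(∫ s in (0:ℝ)..t, β s * (μ + ρ))) :=
    fun t ht => mul_pos (hβpos t ht) (Real.exp_pos _)
  refine ⟨fun hρ => ?_, fun hρ => ?_, fun hρ s hs t ht => ?_⟩
  · refine strictAntiOn_of_deriv_neg (convex_Ioo a b) hc fun t ht => ?_
    rw [interior_Ioo] at ht
    rw [(hd t ht).deriv]
    exact mul_neg_of_neg_of_pos (neg_neg_of_pos hρ) (hpos t ht)
  · refine strictMonoOn_of_deriv_pos (convex_Ioo a b) hc fun t ht => ?_
    rw [interior_Ioo] at ht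
    rw [(hd t ht).deriv]
    exact mul_pos (neg_pos.mpr hρ) (hpos t ht)
  · refine isOpen_Ioo.is_const_of_deriv_eq_zero isPreconnected_Ioo
      (fun x hx => (hd x hx).differentiableAt.differentiableWithinAt) (fun x hx => ?_) hs ht
    rw [(hd x hx).deriv, hρ, neg_zero, zero_mul, Pi.zero_apply]
end

section
/- Let σ ∈ ℝ, T ∈ ℝ and κ > 0. Define ρ : ℝ → ℝ by ρ_t = (κ e^{2(t−T)} + 1)^{−1/2} − 1 and Ỹ : ℝ → ℝ by Ỹ_t = (ρ_t + 1)/(ρ_t + 2). Then at every t ∈ ℝ, Ỹ is differentiable with derivative ((ρ_t + σ² + 2)² Ỹ_t²) / (σ² Ỹ_t + ρ_t + 1) − (σ² + 2) Ỹ_t. -/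
theorem hasDerivAt_rpow_neg_half_logistic {κ : ℝ} (hκ : 0 < κ) (T t : ℝ) :
    HasDerivAt (fun s => (κ * Real.exp (2 * (s - T)) + 1) ^ (-(1 / 2) : ℝ))
      (((κ * Real.exp (2 * (t - T)) + 1) ^ (-(1 / 2) : ℝ)) ^ 3
        - (κ * Real.exp (2 * (t - T)) + 1) ^ (-(1 / 2) : ℝ)) t := by
  have hbase : HasDerivAt (fun s => κ * Real.exp (2 * (s - T)) + 1)
      (κ * (Real.exp (2 * (t - T)) * (2 * 1))) t :=
    (((((hasDerivAt_id t).sub_const T).const_mul 2).exp).const_mul κ).add_const 1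
  have hpos : 0 < κ * Real.exp (2 * (t - T)) + 1 := by positivity
  convert hbase.rpow_const (p := -(1 / 2)) (Or.inl hpos.ne') using 1
  have hcube : (κ * Real.exp (2 * (t - T)) + 1) ^ (-(1 / 2) - 1 : ℝ)
      = ((κ * Real.exp (2 * (t - T)) + 1) ^ (-(1 / 2) : ℝ)) ^ 3 := by
    rw [← Real.rpow_mul_natCast hpos.le]
    norm_num
  have hsq : ((κ * Real.exp (2 * (t - T)) + 1) ^ (-(1 / 2) : ℝ)) ^ 2
      * (κ * Real.exp (2 * (t - T)) + 1) = 1 := by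
    rw [← Real.rpow_mul_natCast hpos.le, ← Real.rpow_add_one hpos.ne']
    norm_num
  rw [hcube]
  linear_combination (κ * Real.exp (2 * (t - T)) + 1) ^ (-(1 / 2) : ℝ) * hsq

theorem stmt_15 (σ T κ : ℝ) (hκ : 0 < κ)
    (ρ : ℝ → ℝ) (hρ : ∀ t, ρ t = (κ * Real.exp (2*(t - T)) + 1) ^ (-(1/2) : ℝ) - 1)
    (Ytil : ℝ → ℝ) (hYtil : ∀ t, Ytil t = (ρ t + 1) / (ρ t + 2)) :
    ∀ t : ℝ,
      HasDerivAt Ytil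
        (((ρ t + σ^2 + 2)^2 * (Ytil t)^2) / (σ^2 * Ytil t + ρ t + 1)
          - (σ^2 + 2) * Ytil t) t := by
  intro t
  have hu : 0 < (κ * Real.exp (2 * (t - T)) + 1) ^ (-(1 / 2) : ℝ) := by positivity
  have hderiv := hasDerivAt_rpow_neg_half_logistic hκ T t
  have hY : Ytil = fun s => (κ * Real.exp (2 * (s - T)) + 1) ^ (-(1 / 2) : ℝ)
      / ((κ * Real.exp (2 * (s - T)) + 1) ^ (-(1 / 2) : ℝ) + 1) := by
    funext s
    rw [hYtil, hρ]
    congr 1 <;> ring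
  rw [hYtil t, hρ t, hY]
  refine (hderiv.fun_div (hderiv.add_const 1) (by positivity)).congr_deriv ?_
  generalize (κ * Real.exp (2 * (t - T)) + 1) ^ (-(1 / 2) : ℝ) = u at hu
  have hden : σ ^ 2 * ((u - 1 + 1) / (u - 1 + 2)) + (u - 1) + 1
      = u * (σ ^ 2 + u + 1) / (u + 1) := by
    rw [show u - 1 + 2 = u + 1 by ring]
    field_simp
    ring
  have hσ : σ ^ 2 + u + 1 ≠ 0 := by positivity
  rw [hden, show u - 1 + 2 = u + 1 by ring]
  field_simp
  ring
end
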